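/- arXiv:2301.09122 — 7 statements merged into one kernel-verified Lean document; each statement's English description precedes it below -/
import Mathlib

section
/- Let I ⊆ ℝ be an interval and let x, y : I → ℝ be differentiable functions with x(t) > 0 for all t ∈ I, satisfying the Dafermos system x'(t) = y(t) and y'(t) = (y(t)² − x(t)²)/(2x(t)) for all t ∈ I. Then the entropy function is invariant along the solution: for all s, t ∈ I, H(x(s), y(s)) = H(x(t), y(t)). -/
/-- The entropy function `H(x,y) = (x² + y²)/(2x)` of the Dafermos system. -/
noncomputable def H (x y : ℝ) : ℝ := (x ^ 2 + y ^ 2) / (2 * x)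

/-- The entropy has zero derivative along a solution of the Dafermos system. -/
theorem hasDerivAt_H_zero {x y : ℝ → ℝ} {t : ℝ} (h0 : x t ≠ 0)
    (hx : HasDerivAt x (y t) t)
    (hy : HasDerivAt y ((y t ^ 2 - x t ^ 2) / (2 * x t)) t) :
    HasDerivAt (fun r => H (x r) (y r)) 0 t := by
  have h := ((hx.pow 2).add (hy.pow 2)).div (hx.const_mul 2) (mul_ne_zero two_ne_zero h0)
  refine h.congr_deriv ?_
  simp only [Pi.add_apply, Pi.pow_apply]
  field_simp
  push_cast
  ring

/-- Along any positive solution of the Dafermos system `x' = y`,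
`y' = (y² − x²)/(2x)` on an interval, the entropy `H` is invariant. -/
theorem entropy_invariant
    (I : Set ℝ) (hI : I.OrdConnected)
    (x y : ℝ → ℝ)
    (hxpos : ∀ t ∈ I, 0 < x t)
    (hx : ∀ t ∈ I, HasDerivAt x (y t) t)
    (hy : ∀ t ∈ I, HasDerivAt y ((y t ^ 2 - x t ^ 2) / (2 * x t)) t) :
    ∀ s ∈ I, ∀ t ∈ I, H (x s) (y s) = H (x t) (y t) := by
  intro s hs t ht
  have h := hI.convex.norm_image_sub_le_of_norm_hasDerivWithin_le (C := 0)
    (fun r hr => (hasDerivAt_H_zero (hxpos r hr).ne' (hx r hr) (hy r hr)).hasDerivWithinAt)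
    (fun _ _ => norm_zero.le) ht hs
  rw [zero_mul] at h
  exact sub_eq_zero.mp (norm_le_zero_iff.mp h)
end

section
/- Let I ⊆ ℝ be an interval containing 0 and let x, y : I → ℝ be differentiable with x(t) > 0 for all t ∈ I, satisfying the Dafermos system x'(t) = y(t), y'(t) = (y(t)² − x(t)²)/(2x(t)), with initial data x(0) = x₀ > 0, y(0) = y₀. Set c₀ := (x₀² + y₀²)/(2x₀). Then the solution lies on the circle of radius c₀ centred at (c₀, 0): for all t ∈ I, (x(t) − c₀)² + y(t)² = c₀². -/
/-- Any positive solution of the Dafermos system `x' = y`, `y' = (y² − x²)/(2x)`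
with initial data `(x₀, y₀)`, `x₀ > 0`, lies on the circle of radius
`c₀ = (x₀² + y₀²)/(2x₀)` centred at `(c₀, 0)`. -/
theorem dafermos_on_circle
    (I : Set ℝ) (hI : I.OrdConnected) (h0 : (0 : ℝ) ∈ I)
    (x y : ℝ → ℝ) (x₀ y₀ : ℝ) (hx₀ : 0 < x₀)
    (hinitx : x 0 = x₀) (hinity : y 0 = y₀)
    (hxpos : ∀ t ∈ I, 0 < x t)
    (hx : ∀ t ∈ I, HasDerivAt x (y t) t)
    (hy : ∀ t ∈ I, HasDerivAt y ((y t ^ 2 - x t ^ 2) / (2 * x t)) t) :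
    ∀ t ∈ I, (x t - (x₀ ^ 2 + y₀ ^ 2) / (2 * x₀)) ^ 2 + y t ^ 2
      = ((x₀ ^ 2 + y₀ ^ 2) / (2 * x₀)) ^ 2 := by
  intro t ht
  have hderiv : ∀ s ∈ I,
      HasDerivWithinAt (fun s ↦ (x s ^ 2 + y s ^ 2) / (2 * x s)) 0 I s := by
    intro s hs
    have hxs : x s ≠ 0 := (hxpos s hs).ne'
    have h := (((hx s hs).pow 2).add ((hy s hs).pow 2)).div ((hx s hs).const_mul 2)
      (mul_ne_zero two_ne_zero hxs)
    refine HasDerivAt.hasDerivWithinAt (h.congr_deriv ?_)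
    simp only [Pi.add_apply, Pi.pow_apply]
    field_simp
    ring
  have hconst : (x t ^ 2 + y t ^ 2) / (2 * x t) = (x 0 ^ 2 + y 0 ^ 2) / (2 * x 0) := by
    have h := hI.convex.norm_image_sub_le_of_norm_hasDerivWithin_le
      hderiv (fun _ _ ↦ norm_zero.le) h0 ht
    rw [zero_mul] at h
    exact sub_eq_zero.mp (norm_le_zero_iff.mp h)
  rw [hinitx, hinity, div_eq_iff (mul_pos two_pos (hxpos t ht)).ne'] at hconst
  linear_combination hconst
end

section
/- Let I ⊆ ℝ be an interval and let r, θ : I → ℝ be differentiable with r(t) > 0 and cos θ(t) > 0 for all t ∈ I, and suppose that x(t) := r(t) cos θ(t), y(t) := r(t) sin θ(t) satisfy the Dafermos system x'(t) = y(t), y'(t) = (y(t)² − x(t)²)/(2x(t)). Then the polar variables satisfy θ'(t) = −1/2 and r'(t) = (1/2) r(t) tan θ(t) for all t ∈ I. -/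
/-- In polar coordinates `x = r cos θ`, `y = r sin θ` (with `r > 0`,
`cos θ > 0`), the Dafermos system `x' = y`, `y' = (y² − x²)/(2x)` becomes
`θ' = −1/2`, `r' = (1/2) r tan θ`. -/
theorem dafermos_polar_form
    (I : Set ℝ) (hI : I.OrdConnected)
    (r θ : ℝ → ℝ)
    (hr : ∀ t ∈ I, DifferentiableAt ℝ r t)
    (hθ : ∀ t ∈ I, DifferentiableAt ℝ θ t)
    (hrpos : ∀ t ∈ I, 0 < r t)
    (hcos : ∀ t ∈ I, 0 < Real.cos (θ t))
    (hx : ∀ t ∈ I, HasDerivAt (fun s => r s * Real.cos (θ s)) (r t * Real.sin (θ t)) t)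
    (hy : ∀ t ∈ I, HasDerivAt (fun s => r s * Real.sin (θ s))
      (((r t * Real.sin (θ t)) ^ 2 - (r t * Real.cos (θ t)) ^ 2)
        / (2 * (r t * Real.cos (θ t)))) t) :
    ∀ t ∈ I, HasDerivAt θ (-(1 / 2)) t ∧
      HasDerivAt r (1 / 2 * r t * Real.tan (θ t)) t := by
  intro t ht
  have hR := (hr t ht).hasDerivAt
  have hΘ := (hθ t ht).hasDerivAt
  have hc := hcos t ht
  have hp := hrpos t ht
  have ex := (hx t ht).unique (hR.mul hΘ.cos)
  have ey := (hy t ht).unique (hR.mul hΘ.sin)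
  have h1 := Real.sin_sq_add_cos_sq (θ t)
  rw [Real.tan_eq_sin_div_cos]
  generalize deriv r t = a at *
  generalize deriv θ t = b at *
  generalize Real.cos (θ t) = c at *
  generalize Real.sin (θ t) = s at *
  have hquot : ((r t * s) ^ 2 - (r t * c) ^ 2) / (2 * (r t * c)) * c
      = r t * (s ^ 2 - c ^ 2) / 2 := by
    field_simp
  have hb : b = -(1 / 2) := by
    apply mul_left_cancel₀ hp.ne'
    linear_combination s * ex - c * ey + hquot - r t * (b + 1 / 2) * h1
  subst hb
  have ha : a = 1 / 2 * r t * (s / c) := by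
    field_simp
    linear_combination -2 * ex
  exact ⟨hΘ, ha ▸ hR⟩
end

section
/- Let x₀ > 0 and y₀ ∈ ℝ with (x₀² + y₀²)/(2x₀) ≥ 1. Then the set of Lipschitz continuous functions (x, y) : [0, ∞) → ℝ² with x(t) ≥ 0, (x(0), y(0)) = (x₀, y₀), satisfying x'(t) = y(t) for all t ≥ 0 and y'(t) = (y(t)² − x(t)²)/(2x(t)) at every t with (x(t), y(t)) ≠ (0, 0), is infinite: there are infinitely many pairwise distinct such solutions with the same initial data. -/
/-- The position of the solution passing through the origin at time `0`, of entropy level `a` before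
and `b` after. -/
noncomputable def dafermosX (a b s : ℝ) : ℝ :=
  a * (1 - Real.cos (min s 0)) + b * (1 - Real.cos (max s 0))

/-- The velocity of the solution passing through the origin at time `0`, of entropy level `a` before
and `b` after. -/
noncomputable def dafermosY (a b s : ℝ) : ℝ :=
  a * Real.sin (min s 0) + b * Real.sin (max s 0)

lemma dafermosX_of_nonpos (a b : ℝ) {s : ℝ} (hs : s ≤ 0) :
    dafermosX a b s = a * (1 - Real.cos s) := by
  simp [dafermosX, hs]

lemma dafermosX_of_nonneg (a b : ℝ) {s : ℝ} (hs : 0 ≤ s) :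
    dafermosX a b s = b * (1 - Real.cos s) := by
  simp [dafermosX, hs]

lemma dafermosY_of_nonpos (a b : ℝ) {s : ℝ} (hs : s ≤ 0) :
    dafermosY a b s = a * Real.sin s := by
  simp [dafermosY, hs]

lemma dafermosY_of_nonneg (a b : ℝ) {s : ℝ} (hs : 0 ≤ s) :
    dafermosY a b s = b * Real.sin s := by
  simp [dafermosY, hs]

lemma dafermosX_nonneg {a b : ℝ} (ha : 0 ≤ a) (hb : 0 ≤ b) (s : ℝ) : 0 ≤ dafermosX a b s :=
  add_nonneg (mul_nonneg ha (sub_nonneg.2 (Real.cos_le_one _)))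
    (mul_nonneg hb (sub_nonneg.2 (Real.cos_le_one _)))

lemma exists_lipschitzWith_const_mul {f : ℝ → ℝ} (hf : LipschitzWith 1 f) (a : ℝ) :
    ∃ K, LipschitzWith K fun s => a * f s := by
  refine ⟨‖a‖₊, LipschitzWith.of_dist_le_mul fun s t => ?_⟩
  have h := hf.dist_le_mul s t
  simp only [Real.dist_eq, NNReal.coe_one, one_mul, coe_nnnorm, Real.norm_eq_abs] at h ⊢
  rw [← mul_sub, abs_mul]
  exact mul_le_mul_of_nonneg_left h (abs_nonneg a)

lemma exists_lipschitzWith_dafermos (a b : ℝ) :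
    ∃ K, LipschitzWith K fun s => (dafermosX a b s, dafermosY a b s) := by
  have hmin : LipschitzWith 1 fun s : ℝ => min s 0 := LipschitzWith.id.min_const 0
  have hmax : LipschitzWith 1 fun s : ℝ => max s 0 := LipschitzWith.id.max_const 0
  have hcos : LipschitzWith 1 fun s : ℝ => 1 - Real.cos s := by
    simpa using (LipschitzWith.const (1 : ℝ)).sub Real.lipschitzWith_cos
  obtain ⟨K₁, h₁⟩ := exists_lipschitzWith_const_mul (by simpa using hcos.comp hmin) a
  obtain ⟨K₂, h₂⟩ := exists_lipschitzWith_const_mul (by simpa using hcos.comp hmax) b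
  obtain ⟨K₃, h₃⟩ :=
    exists_lipschitzWith_const_mul (by simpa using Real.lipschitzWith_sin.comp hmin) a
  obtain ⟨K₄, h₄⟩ :=
    exists_lipschitzWith_const_mul (by simpa using Real.lipschitzWith_sin.comp hmax) b
  exact ⟨_, (h₁.add h₂).prodMk (h₃.add h₄)⟩

lemma hasDerivAt_mul_one_sub_cos (a s : ℝ) :
    HasDerivAt (fun t => a * (1 - Real.cos t)) (a * Real.sin s) s := by
  simpa using ((Real.hasDerivAt_cos s).const_sub 1).const_mul a

lemma hasDerivAt_dafermosX (a b s : ℝ) :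
    HasDerivAt (dafermosX a b) (dafermosY a b s) s := by
  rcases lt_trichotomy s 0 with hs | rfl | hs
  · rw [dafermosY_of_nonpos a b hs.le]
    refine (hasDerivAt_mul_one_sub_cos a s).congr_of_eventuallyEq ?_
    filter_upwards [Iio_mem_nhds hs] with t ht using dafermosX_of_nonpos a b (le_of_lt ht)
  · have hl : HasDerivWithinAt (dafermosX a b) (a * Real.sin 0) (Set.Iic 0) 0 :=
      (hasDerivAt_mul_one_sub_cos a 0).hasDerivWithinAt.congr
        (fun t ht => dafermosX_of_nonpos a b ht) (dafermosX_of_nonpos a b le_rfl)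
    have hr : HasDerivWithinAt (dafermosX a b) (b * Real.sin 0) (Set.Ici 0) 0 :=
      (hasDerivAt_mul_one_sub_cos b 0).hasDerivWithinAt.congr
        (fun t ht => dafermosX_of_nonneg a b ht) (dafermosX_of_nonneg a b le_rfl)
    simp only [Real.sin_zero, mul_zero] at hl hr
    simpa [dafermosY, Set.Iic_union_Ici] using hl.union hr
  · rw [dafermosY_of_nonneg a b hs.le]
    refine (hasDerivAt_mul_one_sub_cos b s).congr_of_eventuallyEq ?_
    filter_upwards [Ioi_mem_nhds hs] with t ht using dafermosX_of_nonneg a b (le_of_lt ht)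

lemma hasDerivAt_mul_sin_of_ne_zero {a s : ℝ}
    (h : (a * (1 - Real.cos s), a * Real.sin s) ≠ (0, 0)) :
    HasDerivAt (fun t => a * Real.sin t)
      (((a * Real.sin s) ^ 2 - (a * (1 - Real.cos s)) ^ 2) / (2 * (a * (1 - Real.cos s)))) s := by
  have ha : a ≠ 0 := by
    rintro rfl
    simp at h
  have hcos : 1 - Real.cos s ≠ 0 := by
    intro hc
    have hsin : Real.sin s = 0 := by
      have := Real.sin_sq_add_cos_sq s
      rw [← sub_eq_zero.1 hc] at this
      simpa using this
    simp [hc, hsin] at h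
  refine ((Real.hasDerivAt_sin s).const_mul a).congr_deriv ?_
  rw [mul_pow, Real.sin_sq]
  field_simp
  ring

lemma hasDerivAt_dafermosY {a b s : ℝ} (h : (dafermosX a b s, dafermosY a b s) ≠ (0, 0)) :
    HasDerivAt (dafermosY a b)
      ((dafermosY a b s ^ 2 - dafermosX a b s ^ 2) / (2 * dafermosX a b s)) s := by
  rcases lt_trichotomy s 0 with hs | rfl | hs
  · rw [dafermosX_of_nonpos a b hs.le, dafermosY_of_nonpos a b hs.le] at h ⊢
    refine (hasDerivAt_mul_sin_of_ne_zero h).congr_of_eventuallyEq ?_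
    filter_upwards [Iio_mem_nhds hs] with t ht using dafermosY_of_nonpos a b (le_of_lt ht)
  · simp [dafermosX, dafermosY] at h
  · rw [dafermosX_of_nonneg a b hs.le, dafermosY_of_nonneg a b hs.le] at h ⊢
    refine (hasDerivAt_mul_sin_of_ne_zero h).congr_of_eventuallyEq ?_
    filter_upwards [Ioi_mem_nhds hs] with t ht using dafermosY_of_nonneg a b (le_of_lt ht)

/-- Every point of the circle of entropy level `c` is reached before the origin is. -/
lemma exists_nonpos_dafermos_eq {c x y : ℝ} (hc : 0 < c) (h : (x - c) ^ 2 + y ^ 2 = c ^ 2) :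
    ∃ φ ≤ 0, ∀ b, dafermosX c b φ = x ∧ dafermosY c b φ = y := by
  set z : ℂ := ⟨c - x, y⟩ with hz
  have hnorm : ‖z‖ = c := by
    rw [← sq_eq_sq₀ (norm_nonneg z) hc.le, Complex.sq_norm, Complex.normSq_apply]
    linear_combination h
  have hcos : c * Real.cos z.arg = c - x := by
    simpa [hnorm] using Complex.norm_mul_cos_arg z
  have hsin : c * Real.sin z.arg = y := by
    simpa [hnorm] using Complex.norm_mul_sin_arg z
  have hφ : z.arg - 2 * Real.pi ≤ 0 := by
    linarith [Complex.arg_le_pi z, Real.pi_pos]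
  refine ⟨_, hφ, fun b => ?_⟩
  rw [dafermosX_of_nonpos c b hφ, dafermosY_of_nonpos c b hφ, Real.cos_sub_two_pi,
    Real.sin_sub_two_pi]
  exact ⟨by linear_combination -hcos, hsin⟩


/-- The Dafermos system with initial data `(x₀, y₀)`, `x₀ > 0`,
`(x₀² + y₀²)/(2x₀) ≥ 1`, has infinitely many pairwise distinct Lipschitz
continuous solutions on `[0, ∞)`. -/
theorem infinitely_many_dafermos_solutions
    (x₀ y₀ : ℝ) (hx₀ : 0 < x₀)
    (hc₀ : 1 ≤ (x₀ ^ 2 + y₀ ^ 2) / (2 * x₀)) :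
    ∃ F : ℕ → (ℝ → ℝ) × (ℝ → ℝ),
      (∀ n, ∃ K : NNReal,
        LipschitzOnWith K (fun t => ((F n).1 t, (F n).2 t)) (Set.Ici 0)) ∧
      (∀ n, ∀ t ∈ Set.Ici (0 : ℝ), 0 ≤ (F n).1 t) ∧
      (∀ n, (F n).1 0 = x₀ ∧ (F n).2 0 = y₀) ∧
      (∀ n, ∀ t ∈ Set.Ici (0 : ℝ),
        HasDerivWithinAt (F n).1 ((F n).2 t) (Set.Ici 0) t) ∧
      (∀ n, ∀ t ∈ Set.Ici (0 : ℝ), ((F n).1 t, (F n).2 t) ≠ (0, 0) →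
        HasDerivWithinAt (F n).2
          (((F n).2 t ^ 2 - (F n).1 t ^ 2) / (2 * (F n).1 t)) (Set.Ici 0) t) ∧
      (∀ m n : ℕ, m ≠ n →
        ∃ t ∈ Set.Ici (0 : ℝ), ((F m).1 t, (F m).2 t) ≠ ((F n).1 t, (F n).2 t)) := by
  set c := (x₀ ^ 2 + y₀ ^ 2) / (2 * x₀) with hc
  have hcpos : 0 < c := one_pos.trans_le hc₀
  have hcircle : (x₀ - c) ^ 2 + y₀ ^ 2 = c ^ 2 := by
    rw [eq_div_iff (by positivity)] at hc
    linear_combination -hc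
  obtain ⟨φ, hφ, h0⟩ := exists_nonpos_dafermos_eq hcpos hcircle
  refine ⟨fun n => (fun t => dafermosX c n (t + φ), fun t => dafermosY c n (t + φ)),
    fun n => ?_, fun n t _ => dafermosX_nonneg hcpos.le n.cast_nonneg _,
    fun n => by simpa using h0 n,
    fun n t _ => ((hasDerivAt_dafermosX c n (t + φ)).comp_add_const t φ).hasDerivWithinAt,
    fun n t _ h => ((hasDerivAt_dafermosY h).comp_add_const t φ).hasDerivWithinAt,
    fun m n hmn => ⟨Real.pi - φ, ?_, fun h => hmn ?_⟩⟩
  · obtain ⟨K, hK⟩ := exists_lipschitzWith_dafermos c n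
    refine ⟨K, LipschitzWith.lipschitzOnWith ?_⟩
    simpa [Function.comp_def] using hK.comp (LipschitzWith.id.add (LipschitzWith.const φ))
  · exact Set.mem_Ici.2 (by linarith [Real.pi_pos])
  · have hX := congrArg Prod.fst h
    simp only [sub_add_cancel, dafermosX_of_nonneg _ _ Real.pi_pos.le, Real.cos_pi] at hX
    exact_mod_cast (mul_left_inj' (by norm_num : (1 - -1 : ℝ) ≠ 0)).1 hX
end

section
/- Define u(x,y) := y, v(x,y) := (y² − x²)/(2x), ρ(x,y) := 1/x, and the pressure p(x,y) := (x² + y²)/(2x) − 1. Then at every point (x,y) with x > 0, the balance of steady linear momentum for the compressible Euler equations holds: ∂/∂x (ρ u²) + ∂/∂y (ρ u v) + ∂p/∂x = 0 and ∂/∂x (ρ u v) + ∂/∂y (ρ v²) + ∂p/∂y = 0. -/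
/-- Velocity component `u(x,y) = y`. -/
noncomputable def u (x y : ℝ) : ℝ := y

/-- Velocity component `v(x,y) = (y² − x²)/(2x)`. -/
noncomputable def v (x y : ℝ) : ℝ := (y ^ 2 - x ^ 2) / (2 * x)

/-- Mass density `ρ(x,y) = 1/x`. -/
noncomputable def ρ (x y : ℝ) : ℝ := 1 / x

/-- Pressure `p(x,y) = (x² + y²)/(2x) − 1`. -/
noncomputable def p (x y : ℝ) : ℝ := (x ^ 2 + y ^ 2) / (2 * x) - 1

theorem hasDerivAt_u_left (x y : ℝ) : HasDerivAt (fun s => u s y) 0 x :=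
  hasDerivAt_const x y

theorem hasDerivAt_u_right (x y : ℝ) : HasDerivAt (fun s => u x s) 1 y :=
  hasDerivAt_id y

theorem hasDerivAt_v_left {x : ℝ} (hx : x ≠ 0) (y : ℝ) :
    HasDerivAt (fun s => v s y) (-(x ^ 2 + y ^ 2) / (2 * x ^ 2)) x := by
  unfold v
  refine (((hasDerivAt_pow 2 x).const_sub (y ^ 2)).fun_div
    ((hasDerivAt_id' x).const_mul 2) (mul_ne_zero two_ne_zero hx)).congr_deriv ?_
  norm_num
  field_simp
  ring

theorem hasDerivAt_v_right (x y : ℝ) : HasDerivAt (fun s => v x s) (y / x) y := by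
  unfold v
  refine (((hasDerivAt_pow 2 y).sub_const (x ^ 2)).div_const (2 * x)).congr_deriv ?_
  norm_num
  field_simp

theorem hasDerivAt_ρ_left {x : ℝ} (hx : x ≠ 0) (y : ℝ) :
    HasDerivAt (fun s => ρ s y) (-1 / x ^ 2) x := by
  simpa [ρ, neg_div] using hasDerivAt_inv hx

theorem hasDerivAt_p_left {x : ℝ} (hx : x ≠ 0) (y : ℝ) :
    HasDerivAt (fun s => p s y) ((x ^ 2 - y ^ 2) / (2 * x ^ 2)) x := by
  unfold p
  refine ((((hasDerivAt_pow 2 x).add_const (y ^ 2)).fun_div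
    ((hasDerivAt_id' x).const_mul 2) (mul_ne_zero two_ne_zero hx)).sub_const 1).congr_deriv ?_
  norm_num
  field_simp
  ring

theorem hasDerivAt_p_right (x y : ℝ) : HasDerivAt (fun s => p x s) (y / x) y := by
  unfold p
  refine ((((hasDerivAt_pow 2 y).const_add (x ^ 2)).div_const (2 * x)).sub_const 1).congr_deriv ?_
  norm_num
  field_simp

/-- The velocity `u = y`, `v = (y² − x²)/(2x)`, density `ρ = 1/x` and pressure
`p = (x² + y²)/(2x) − 1` satisfy the steady compressible Euler momentum
equations for `x > 0`. -/
theorem euler_momentum_balance (x y : ℝ) (hx : 0 < x) :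
    (deriv (fun s => ρ s y * u s y ^ 2) x
      + deriv (fun s => ρ x s * u x s * v x s) y
      + deriv (fun s => p s y) x = 0) ∧
    (deriv (fun s => ρ s y * u s y * v s y) x
      + deriv (fun s => ρ x s * v x s ^ 2) y
      + deriv (fun s => p x s) y = 0) := by
  have hx₀ := hx.ne'
  have hρ : HasDerivAt (fun s => ρ x s) 0 y := hasDerivAt_const y (1 / x)
  have huu := (hasDerivAt_ρ_left hx₀ y).fun_mul ((hasDerivAt_u_left x y).fun_pow 2)
  have huv_right := (hρ.fun_mul (hasDerivAt_u_right x y)).fun_mul (hasDerivAt_v_right x y)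
  have huv_left := ((hasDerivAt_ρ_left hx₀ y).fun_mul (hasDerivAt_u_left x y)).fun_mul
    (hasDerivAt_v_left hx₀ y)
  have hvv := hρ.fun_mul ((hasDerivAt_v_right x y).fun_pow 2)
  rw [huu.deriv, huv_right.deriv, (hasDerivAt_p_left hx₀ y).deriv,
    huv_left.deriv, hvv.deriv, (hasDerivAt_p_right x y).deriv]
  simp only [u, v, ρ]
  constructor <;> (norm_num; field_simp; ring)
end

section
/- Define u(x,y) := y, v(x,y) := (y² − x²)/(2x), ρ(x,y) := 1/x, p(x,y) := (x² + y²)/(2x) − 1, and the viscosity coefficients μ(x,y) := 4x²/(x² + y²) (equal to 4cos²θ in polar coordinates) and λ(x,y) := −4 (x/y) arctan(y/x) − 4x²/(x² + y²) (equal to −4θ cot θ − 4cos²θ). Define the total stress Σ₁₁ := −p + (λ + 2μ) ∂u/∂x + λ ∂v/∂y, Σ₂₂ := −p + (λ + 2μ) ∂v/∂y + λ ∂u/∂x, Σ₁₂ := μ(∂u/∂y + ∂v/∂x). Then at every point (x,y) with x > 0 and y ≠ 0, the steady compressible Navier–Stokes momentum equations hold: ∂(ρu²)/∂x + ∂(ρuv)/∂y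 = ∂Σ₁₁/∂x + ∂Σ₁₂/∂y and ∂(ρuv)/∂x + ∂(ρv²)/∂y = ∂Σ₁₂/∂x + ∂Σ₂₂/∂y. -/
/-- Shear viscosity `μ = 4cos²θ = 4x²/(x² + y²)`. -/
noncomputable def μ (x y : ℝ) : ℝ := 4 * x ^ 2 / (x ^ 2 + y ^ 2)

/-- Volume viscosity `λ = −4θ cot θ − 4cos²θ = −4(x/y)arctan(y/x) − 4x²/(x² + y²)`. -/
noncomputable def lam (x y : ℝ) : ℝ :=
  -4 * (x / y) * Real.arctan (y / x) - 4 * x ^ 2 / (x ^ 2 + y ^ 2)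

/-- Partial derivative `∂u/∂x`. -/
noncomputable def ux (x y : ℝ) : ℝ := deriv (fun s => u s y) x

/-- Partial derivative `∂u/∂y`. -/
noncomputable def uy (x y : ℝ) : ℝ := deriv (fun s => u x s) y

/-- Partial derivative `∂v/∂x`. -/
noncomputable def vx (x y : ℝ) : ℝ := deriv (fun s => v s y) x

/-- Partial derivative `∂v/∂y`. -/
noncomputable def vy (x y : ℝ) : ℝ := deriv (fun s => v x s) y

/-- Total stress component `Σ₁₁ = −p + (λ + 2μ)u_x + λ v_y`. -/
noncomputable def S11 (x y : ℝ) : ℝ :=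
  -p x y + (lam x y + 2 * μ x y) * ux x y + lam x y * vy x y

/-- Total stress component `Σ₂₂ = −p + (λ + 2μ)v_y + λ u_x`. -/
noncomputable def S22 (x y : ℝ) : ℝ :=
  -p x y + (lam x y + 2 * μ x y) * vy x y + lam x y * ux x y

/-- Total stress component `Σ₁₂ = μ(u_y + v_x)`. -/
noncomputable def S12 (x y : ℝ) : ℝ := μ x y * (uy x y + vx x y)

theorem ux_eq (x y : ℝ) : ux x y = 0 := by
  simp [ux, u]

theorem uy_eq (x y : ℝ) : uy x y = 1 := by
  simp [uy, u]

theorem vx_eq {x : ℝ} (y : ℝ) (hx : x ≠ 0) : vx x y = -(x ^ 2 + y ^ 2) / (2 * x ^ 2) := by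
  have h := ((hasDerivAt_id' x).pow 2).const_sub (y ^ 2) |>.div
    ((hasDerivAt_id' x).const_mul 2) (mul_ne_zero two_ne_zero hx)
  refine h.deriv.trans ?_
  simp
  field_simp
  ring

theorem vy_eq (x y : ℝ) : vy x y = y / x := by
  have h := (((hasDerivAt_id' y).pow 2).sub_const (x ^ 2)).div_const (2 * x)
  refine h.deriv.trans ?_
  simp
  field_simp

theorem S11_eq {x y : ℝ} (hx : x ≠ 0) (hy : y ≠ 0) :
    S11 x y = 1 - (x ^ 2 + y ^ 2) / (2 * x) - 4 * Real.arctan (y / x)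
      - 4 * (x * y) / (x ^ 2 + y ^ 2) := by
  have hr : x ^ 2 + y ^ 2 ≠ 0 := by positivity
  simp only [S11, ux_eq, vy_eq, p, lam, μ]
  field_simp
  ring

theorem S22_eq {x y : ℝ} (hx : x ≠ 0) (hy : y ≠ 0) :
    S22 x y = 1 - (x ^ 2 + y ^ 2) / (2 * x) - 4 * Real.arctan (y / x)
      + 4 * (x * y) / (x ^ 2 + y ^ 2) := by
  have hr : x ^ 2 + y ^ 2 ≠ 0 := by positivity
  simp only [S22, ux_eq, vy_eq, p, lam, μ]
  field_simp
  ring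

theorem S12_eq {x : ℝ} (y : ℝ) (hx : x ≠ 0) :
    S12 x y = 4 * x ^ 2 / (x ^ 2 + y ^ 2) - 2 := by
  have hr : x ^ 2 + y ^ 2 ≠ 0 := by positivity
  simp only [S12, uy_eq, vx_eq y hx, μ]
  field_simp
  ring

theorem deriv_S11_fst {x y : ℝ} (hx : x ≠ 0) (hy : y ≠ 0) :
    deriv (fun s => S11 s y) x
      = y ^ 2 / (2 * x ^ 2) - 1 / 2 + 8 * x ^ 2 * y / (x ^ 2 + y ^ 2) ^ 2 := by
  have hr : x ^ 2 + y ^ 2 ≠ 0 := by positivity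
  have e : (fun s => S11 s y) =ᶠ[nhds x] fun s => 1 - (s ^ 2 + y ^ 2) / (2 * s)
      - 4 * Real.arctan (y / s) - 4 * (s * y) / (s ^ 2 + y ^ 2) := by
    filter_upwards [isOpen_ne.mem_nhds hx] with s hs using S11_eq hs hy
  have hid := hasDerivAt_id' x
  have hsq := (hid.pow 2).add_const (y ^ 2)
  have h := (((hsq.div (hid.const_mul 2) (mul_ne_zero two_ne_zero hx)).const_sub 1).sub
    (((hasDerivAt_const x y).div hid hx).arctan.const_mul 4)).sub
    (((hid.mul_const y).const_mul 4).div hsq hr)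
  refine e.deriv_eq.trans (h.deriv.trans ?_)
  have hr' : 1 + (y / x) ^ 2 = (x ^ 2 + y ^ 2) / x ^ 2 := by field_simp
  simp [hr']
  field_simp
  ring

theorem deriv_S22_snd {x y : ℝ} (hx : x ≠ 0) (hy : y ≠ 0) :
    deriv (fun s => S22 x s) y = -y / x - 8 * x * y ^ 2 / (x ^ 2 + y ^ 2) ^ 2 := by
  have hr : x ^ 2 + y ^ 2 ≠ 0 := by positivity
  have e : (fun s => S22 x s) =ᶠ[nhds y] fun s => 1 - (x ^ 2 + s ^ 2) / (2 * x)
      - 4 * Real.arctan (s / x) + 4 * (x * s) / (x ^ 2 + s ^ 2) := by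
    filter_upwards [isOpen_ne.mem_nhds hy] with s hs using S22_eq hx hs
  have hid := hasDerivAt_id' y
  have hsq := (hid.pow 2).const_add (x ^ 2)
  have h := (((hsq.div_const (2 * x)).const_sub 1).sub
    ((hid.div_const x).arctan.const_mul 4)).add
    (((hid.const_mul x).const_mul 4).div hsq hr)
  refine e.deriv_eq.trans (h.deriv.trans ?_)
  have hr' : 1 + (y / x) ^ 2 = (x ^ 2 + y ^ 2) / x ^ 2 := by field_simp
  simp [hr']
  field_simp
  ring

theorem deriv_S12_fst {x : ℝ} (y : ℝ) (hx : x ≠ 0) :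
    deriv (fun s => S12 s y) x = 8 * x * y ^ 2 / (x ^ 2 + y ^ 2) ^ 2 := by
  have hr : x ^ 2 + y ^ 2 ≠ 0 := by positivity
  have e : (fun s => S12 s y) =ᶠ[nhds x] fun s => 4 * s ^ 2 / (s ^ 2 + y ^ 2) - 2 := by
    filter_upwards [isOpen_ne.mem_nhds hx] with s hs using S12_eq y hs
  have hsq := (hasDerivAt_id' x).pow 2
  have h := ((hsq.const_mul 4).div (hsq.add_const (y ^ 2)) hr).sub_const 2
  refine e.deriv_eq.trans (h.deriv.trans ?_)
  simp
  field_simp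
  ring

theorem deriv_S12_snd {x : ℝ} (y : ℝ) (hx : x ≠ 0) :
    deriv (fun s => S12 x s) y = -(8 * x ^ 2 * y) / (x ^ 2 + y ^ 2) ^ 2 := by
  have hr : x ^ 2 + y ^ 2 ≠ 0 := by positivity
  have e : (fun s => S12 x s) = fun s => 4 * x ^ 2 / (x ^ 2 + s ^ 2) - 2 :=
    funext fun s => S12_eq s hx
  have h := ((hasDerivAt_const y (4 * x ^ 2)).div
    (((hasDerivAt_id' y).pow 2).const_add (x ^ 2)) hr).sub_const 2
  rw [e]
  refine h.deriv.trans ?_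
  simp
  field_simp
  ring

theorem deriv_momentum_flux_uu_fst {x : ℝ} (y : ℝ) (hx : x ≠ 0) :
    deriv (fun s => ρ s y * u s y ^ 2) x = -y ^ 2 / x ^ 2 := by
  have h := ((hasDerivAt_const x (1 : ℝ)).div (hasDerivAt_id' x) hx).mul_const (y ^ 2)
  refine h.deriv.trans ?_
  simp
  field_simp

theorem deriv_momentum_flux_uv_snd (x y : ℝ) :
    deriv (fun s => ρ x s * u x s * v x s) y = (3 * y ^ 2 - x ^ 2) / (2 * x ^ 2) := by
  have hid := hasDerivAt_id' y
  have h := (hid.const_mul (1 / x)).mul (((hid.pow 2).sub_const (x ^ 2)).div_const (2 * x))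
  refine h.deriv.trans ?_
  simp
  field_simp
  ring

theorem deriv_momentum_flux_uv_fst {x : ℝ} (y : ℝ) (hx : x ≠ 0) :
    deriv (fun s => ρ s y * u s y * v s y) x = -y ^ 3 / x ^ 3 := by
  have hid := hasDerivAt_id' x
  have h := (((hasDerivAt_const x (1 : ℝ)).div hid hx).mul_const y).mul
    (((hid.pow 2).const_sub (y ^ 2)).div (hid.const_mul 2) (mul_ne_zero two_ne_zero hx))
  refine h.deriv.trans ?_
  simp
  field_simp
  ring

theorem deriv_momentum_flux_vv_snd (x y : ℝ) :
    deriv (fun s => ρ x s * v x s ^ 2) y = y * (y ^ 2 - x ^ 2) / x ^ 3 := by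
  have h := (((((hasDerivAt_id' y).pow 2).sub_const (x ^ 2)).div_const (2 * x)).pow 2).const_mul
    (1 / x)
  refine h.deriv.trans ?_
  simp
  field_simp

/-- With the chosen viscosities `μ`, `λ`, the flow `u = y`,
`v = (y² − x²)/(2x)`, `ρ = 1/x`, `p = (x² + y²)/(2x) − 1` satisfies the steady
compressible Navier–Stokes momentum equations for `x > 0`, `y ≠ 0`. -/
theorem navier_stokes_momentum_balance (x y : ℝ) (hx : 0 < x) (hy : y ≠ 0) :
    (deriv (fun s => ρ s y * u s y ^ 2) x
        + deriv (fun s => ρ x s * u x s * v x s) y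
      = deriv (fun s => S11 s y) x + deriv (fun s => S12 x s) y) ∧
    (deriv (fun s => ρ s y * u s y * v s y) x
        + deriv (fun s => ρ x s * v x s ^ 2) y
      = deriv (fun s => S12 s y) x + deriv (fun s => S22 x s) y) := by
  have hx' : x ≠ 0 := hx.ne'
  have hr : x ^ 2 + y ^ 2 ≠ 0 := by positivity
  rw [deriv_momentum_flux_uu_fst y hx', deriv_momentum_flux_uv_snd, deriv_S11_fst hx' hy,
    deriv_S12_snd y hx', deriv_momentum_flux_uv_fst y hx', deriv_momentum_flux_vv_snd,
    deriv_S12_fst y hx', deriv_S22_snd hx' hy]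
  constructor <;> field_simp <;> ring
end

section
/- Define χ(x,y) := 2(x² + y²) arctan(y/x). Then at every point (x,y) with x > 0 and x² ≠ y², χ satisfies the second-order partial differential equation χ_xx − χ_yy − Λ(x,y) χ_xy = 0, where Λ(x,y) := −4xy/(x² − y²). -/
/-- The Airy stress function `χ(x,y) = 2(x² + y²)arctan(y/x)`. -/
noncomputable def χ (x y : ℝ) : ℝ := 2 * (x ^ 2 + y ^ 2) * Real.arctan (y / x)

/-- Partial derivative `∂χ/∂x`. -/
noncomputable def χx (x y : ℝ) : ℝ := deriv (fun s => χ s y) x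

/-- Partial derivative `∂χ/∂y`. -/
noncomputable def χy (x y : ℝ) : ℝ := deriv (fun s => χ x s) y

theorem hasDerivAt_arctan_div_left {x : ℝ} (y : ℝ) (hx : x ≠ 0) :
    HasDerivAt (fun s => Real.arctan (y / s)) (-y / (x ^ 2 + y ^ 2)) x := by
  have hr : x ^ 2 + y ^ 2 ≠ 0 := by positivity
  convert ((hasDerivAt_const x y).fun_div (hasDerivAt_id' x) hx).arctan using 1
  field_simp
  ring

theorem hasDerivAt_arctan_div_right {x : ℝ} (y : ℝ) (hx : x ≠ 0) :
    HasDerivAt (fun s => Real.arctan (s / x)) (x / (x ^ 2 + y ^ 2)) y := by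
  have hr : x ^ 2 + y ^ 2 ≠ 0 := by positivity
  convert ((hasDerivAt_id' y).div_const x).arctan using 1
  field_simp

theorem χx_eq {x : ℝ} (y : ℝ) (hx : x ≠ 0) :
    χx x y = 4 * x * Real.arctan (y / x) - 2 * y := by
  have hr : x ^ 2 + y ^ 2 ≠ 0 := by positivity
  refine HasDerivAt.deriv ?_
  unfold χ
  refine ((((hasDerivAt_pow 2 x).add_const (y ^ 2)).const_mul 2).fun_mul
    (hasDerivAt_arctan_div_left y hx)).congr_deriv ?_
  push_cast
  field_simp
  ring

theorem χy_eq {x : ℝ} (y : ℝ) (hx : x ≠ 0) :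
    χy x y = 4 * y * Real.arctan (y / x) + 2 * x := by
  have hr : x ^ 2 + y ^ 2 ≠ 0 := by positivity
  refine HasDerivAt.deriv ?_
  unfold χ
  refine ((((hasDerivAt_pow 2 y).const_add (x ^ 2)).const_mul 2).fun_mul
    (hasDerivAt_arctan_div_right y hx)).congr_deriv ?_
  push_cast
  field_simp
  ring

theorem deriv_χx_left {x : ℝ} (y : ℝ) (hx : x ≠ 0) :
    deriv (fun s => χx s y) x = 4 * Real.arctan (y / x) - 4 * x * y / (x ^ 2 + y ^ 2) := by
  have heq : (fun s => χx s y) =ᶠ[nhds x] fun s => 4 * s * Real.arctan (y / s) - 2 * y := by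
    filter_upwards [eventually_ne_nhds hx] with s hs using χx_eq y hs
  rw [heq.deriv_eq]
  refine HasDerivAt.deriv ?_
  convert (((hasDerivAt_id' x).const_mul 4).fun_mul
    (hasDerivAt_arctan_div_left y hx)).sub_const (2 * y) using 1
  ring

theorem deriv_χy_right {x : ℝ} (y : ℝ) (hx : x ≠ 0) :
    deriv (fun s => χy x s) y = 4 * Real.arctan (y / x) + 4 * x * y / (x ^ 2 + y ^ 2) := by
  simp only [χy_eq _ hx]
  refine HasDerivAt.deriv ?_
  convert (((hasDerivAt_id' y).const_mul 4).fun_mul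
    (hasDerivAt_arctan_div_right y hx)).add_const (2 * x) using 1
  ring

theorem deriv_χx_right {x : ℝ} (y : ℝ) (hx : x ≠ 0) :
    deriv (fun s => χx x s) y = 2 * (x ^ 2 - y ^ 2) / (x ^ 2 + y ^ 2) := by
  have hr : x ^ 2 + y ^ 2 ≠ 0 := by positivity
  simp only [χx_eq _ hx]
  refine HasDerivAt.deriv ?_
  convert ((hasDerivAt_arctan_div_right y hx).const_mul (4 * x)).fun_sub
    ((hasDerivAt_id' y).const_mul 2) using 1
  field_simp
  ring

/-- The Airy stress function `χ = 2(x² + y²)arctan(y/x)` satisfies the PDE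
`χ_xx − χ_yy − Λ χ_xy = 0` with `Λ = −4xy/(x² − y²)`, for `x > 0`, `x² ≠ y²`. -/
theorem airy_pde (x y : ℝ) (hx : 0 < x) (hxy : x ^ 2 ≠ y ^ 2) :
    deriv (fun s => χx s y) x - deriv (fun s => χy x s) y
      - (-4 * x * y / (x ^ 2 - y ^ 2)) * deriv (fun s => χx x s) y = 0 := by
  have hr : x ^ 2 + y ^ 2 ≠ 0 := by positivity
  have hd : x ^ 2 - y ^ 2 ≠ 0 := sub_ne_zero.mpr hxy
  rw [deriv_χx_left y hx.ne', deriv_χy_right y hx.ne', deriv_χx_right y hx.ne']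
  field_simp
  ring
end
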